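/- arXiv:1206.4074 — 7 statements merged into one kernel-verified Lean document; each statement's English description precedes it below -/
import Mathlib

section
/- Let x, y ≥ 0 with x + y > 0, let k : ℕ → ℝ be a sequence of positive parameters, and for q ≥ 1 define c_q(x) = (∏_{p=1}^{q−1} (x − k_p)/(x + k_p)) · (2√(k_q)·x/(x + k_q)). Then for every N ≥ 0, 2xy/(x+y) − ∑_{q=1}^{N} c_q(x)·c_q(y) = (∏_{i=1}^{N} ((x − k_i)(y − k_i))/((x + k_i)(y + k_i))) · (2xy/(x+y)). -/
open Finset

theorem chi2_direct_series_error (x y : ℝ) (hx : 0 ≤ x) (hy : 0 ≤ y) (hxy : 0 < x + y)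
    (k : ℕ → ℝ) (hk : ∀ q, 0 < k q) (N : ℕ) :
    2 * x * y / (x + y) -
        ∑ q ∈ Finset.Icc 1 N,
          ((∏ p ∈ Finset.Icc 1 (q - 1), (x - k p) / (x + k p)) *
              (2 * Real.sqrt (k q) * x / (x + k q))) *
            ((∏ p ∈ Finset.Icc 1 (q - 1), (y - k p) / (y + k p)) *
              (2 * Real.sqrt (k q) * y / (y + k q)))
      = (∏ i ∈ Finset.Icc 1 N, ((x - k i) * (y - k i)) / ((x + k i) * (y + k i))) *
          (2 * x * y / (x + y)) := by
  induction N with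
  | zero => simp
  | succ n ih =>
    have hx' : x + k (n + 1) ≠ 0 := (add_pos_of_nonneg_of_pos hx (hk _)).ne'
    have hy' : y + k (n + 1) ≠ 0 := (add_pos_of_nonneg_of_pos hy (hk _)).ne'
    have hprod : ∏ i ∈ Finset.Icc 1 n, ((x - k i) * (y - k i)) / ((x + k i) * (y + k i)) =
        (∏ p ∈ Finset.Icc 1 n, (x - k p) / (x + k p)) *
          ∏ p ∈ Finset.Icc 1 n, (y - k p) / (y + k p) := by
      simp only [← Finset.prod_mul_distrib, div_mul_div_comm]
    have hfeature : (2 * Real.sqrt (k (n + 1)) * x / (x + k (n + 1))) *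
        (2 * Real.sqrt (k (n + 1)) * y / (y + k (n + 1))) =
        (1 - ((x - k (n + 1)) * (y - k (n + 1))) / ((x + k (n + 1)) * (y + k (n + 1)))) *
          (2 * x * y / (x + y)) := by
      have hsqrt := Real.sq_sqrt (hk (n + 1)).le
      field_simp
      rw [hsqrt]
      ring
    rw [Finset.sum_Icc_succ_top (by omega), Finset.prod_Icc_succ_top (by omega), ← sub_sub, ih,
      Nat.add_sub_cancel, mul_mul_mul_comm, hfeature, hprod]
    ring
end

section
/- Let x > 0 and 0 < y ≤ 1, let k_1, …, k_N be positive parameters, and for q ≥ 1 define c_q(x) = (∏_{p=1}^{q−1} (x − k_p)/(x + k_p)) · (2√(k_q)·x/(x + k_q)). Then |2xy/(x+y) − ∑_{q=1}^{N} c_q(x)·c_q(y)| ≤ (∏_{i=1}^{N} |x − k_i|/(x + k_i)) · (2x/(x + 1)). -/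
open Finset

/-- The remainder of the direct approximation of `2xy/(x+y)` is a product of reflection factors. -/
theorem chi2_sub_sum_eq {x y : ℝ} (hx : 0 < x) (hy : 0 < y) (k : ℕ → ℝ) (N : ℕ)
    (hk : ∀ i ∈ Finset.Icc 1 N, 0 < k i) :
    2 * x * y / (x + y) -
        ∑ q ∈ Finset.Icc 1 N,
          ((∏ p ∈ Finset.Icc 1 (q - 1), (x - k p) / (x + k p)) *
              (2 * Real.sqrt (k q) * x / (x + k q))) *
            ((∏ p ∈ Finset.Icc 1 (q - 1), (y - k p) / (y + k p)) *
              (2 * Real.sqrt (k q) * y / (y + k q)))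
      = (∏ i ∈ Finset.Icc 1 N, (x - k i) / (x + k i)) *
          (∏ i ∈ Finset.Icc 1 N, (y - k i) / (y + k i)) * (2 * x * y / (x + y)) := by
  induction N with
  | zero => simp
  | succ n ih =>
    have hn : 0 < k (n + 1) := hk _ (by simp)
    have ih' := ih fun i hi => hk i (Finset.Icc_subset_Icc_right n.le_succ hi)
    rw [Finset.sum_Icc_succ_top (by lia), Finset.prod_Icc_succ_top (by lia),
      Finset.prod_Icc_succ_top (by lia), ← sub_sub, ih', Nat.add_sub_cancel]
    generalize ∏ i ∈ Finset.Icc 1 n, (x - k i) / (x + k i) = P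
    generalize ∏ i ∈ Finset.Icc 1 n, (y - k i) / (y + k i) = Q
    have hfeature : 2 * Real.sqrt (k (n + 1)) * x / (x + k (n + 1)) *
        (2 * Real.sqrt (k (n + 1)) * y / (y + k (n + 1))) =
        4 * k (n + 1) * x * y / ((x + k (n + 1)) * (y + k (n + 1))) := by
      rw [div_mul_div_comm]
      congr 1
      linear_combination 4 * x * y * Real.mul_self_sqrt hn.le
    rw [mul_mul_mul_comm P, hfeature]
    field_simp
    ring

theorem abs_sub_div_add_le_one {a b : ℝ} (ha : 0 < a) (hb : 0 < b) :
    |(a - b) / (a + b)| ≤ 1 := by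
  rw [abs_div, abs_of_pos (add_pos ha hb)]
  exact div_le_one_of_le₀ (abs_le.2 ⟨by linarith, by linarith⟩) (by positivity)

theorem chi2_direct_error_bound (x y : ℝ) (hx : 0 < x) (hy0 : 0 < y) (hy1 : y ≤ 1)
    (N : ℕ) (k : ℕ → ℝ) (hk : ∀ i ∈ Finset.Icc 1 N, 0 < k i) :
    |2 * x * y / (x + y) -
        ∑ q ∈ Finset.Icc 1 N,
          ((∏ p ∈ Finset.Icc 1 (q - 1), (x - k p) / (x + k p)) *
              (2 * Real.sqrt (k q) * x / (x + k q))) *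
            ((∏ p ∈ Finset.Icc 1 (q - 1), (y - k p) / (y + k p)) *
              (2 * Real.sqrt (k q) * y / (y + k q)))|
      ≤ (∏ i ∈ Finset.Icc 1 N, |x - k i| / (x + k i)) * (2 * x / (x + 1)) := by
  rw [chi2_sub_sum_eq hx hy0 k N hk, abs_mul, abs_mul, Finset.abs_prod, Finset.abs_prod,
    abs_of_pos (by positivity : 0 < 2 * x * y / (x + y)), mul_assoc]
  have hprod : ∏ i ∈ Finset.Icc 1 N, |(x - k i) / (x + k i)| =
      ∏ i ∈ Finset.Icc 1 N, |x - k i| / (x + k i) :=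
    Finset.prod_congr rfl fun i hi => by rw [abs_div, abs_of_pos (add_pos hx (hk i hi))]
  have hy_prod : ∏ i ∈ Finset.Icc 1 N, |(y - k i) / (y + k i)| ≤ 1 :=
    Finset.prod_le_one (fun _ _ => abs_nonneg _) fun i hi =>
      abs_sub_div_add_le_one hy0 (hk i hi)
  have hkernel : 2 * x * y / (x + y) ≤ 2 * x / (x + 1) := by
    rw [div_le_div_iff₀ (by positivity) (by positivity)]
    nlinarith [mul_nonneg (sq_nonneg x) (sub_nonneg.2 hy1)]
  rw [← hprod]
  refine mul_le_mul_of_nonneg_left ?_ (Finset.prod_nonneg fun _ _ => abs_nonneg _)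
  exact (mul_le_of_le_one_left (by positivity) hy_prod).trans hkernel
end

section
/- Let 0 < x ≤ 1, 0 < y ≤ 1, and 0 < k ≤ 1, and take all parameters equal: k_1 = … = k_N = k, with c_q(x) = ((x − k)/(x + k))^{q−1} · (2√k·x/(x + k)). Then |2xy/(x+y) − ∑_{q=1}^{N} c_q(x)·c_q(y)| ≤ r^{2N} · (2xy/(x+y)), where r = max(|(x−k)/(x+k)|, |(y−k)/(y+k)|) < 1; in particular the approximation error converges to zero geometrically in N. -/
open Finset

theorem chi2_direct_remainder {x y k : ℝ} (hx : 0 < x) (hy : 0 < y) (hk : 0 < k) (N : ℕ) :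
    2 * x * y / (x + y) -
        ∑ q ∈ Finset.Icc 1 N,
          (((x - k) / (x + k)) ^ (q - 1) * (2 * Real.sqrt k * x / (x + k))) *
            (((y - k) / (y + k)) ^ (q - 1) * (2 * Real.sqrt k * y / (y + k))) =
      ((x - k) / (x + k) * ((y - k) / (y + k))) ^ N * (2 * x * y / (x + y)) := by
  have first_term : 2 * Real.sqrt k * x / (x + k) * (2 * Real.sqrt k * y / (y + k)) =
      (1 - (x - k) / (x + k) * ((y - k) / (y + k))) * (2 * x * y / (x + y)) := by
    have hs : Real.sqrt k ^ 2 = k := Real.sq_sqrt hk.le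
    field_simp
    rw [hs]
    ring
  induction N with
  | zero => simp
  | succ n ih =>
    rw [Finset.sum_Icc_succ_top (by omega), ← sub_sub, ih, Nat.add_sub_cancel,
      mul_mul_mul_comm, first_term, ← mul_pow]
    ring

theorem abs_sub_div_add_lt_one {x k : ℝ} (hx : 0 < x) (hk : 0 < k) :
    |(x - k) / (x + k)| < 1 := by
  have hxk : 0 < x + k := add_pos hx hk
  rw [abs_lt, lt_div_iff₀ hxk, div_lt_one hxk]
  constructor <;> linarith

theorem chi2_direct_geometric_convergence (x y k : ℝ)
    (hx : x ∈ Set.Ioc (0 : ℝ) 1) (hy : y ∈ Set.Ioc (0 : ℝ) 1)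
    (hk : k ∈ Set.Ioc (0 : ℝ) 1) (N : ℕ) :
    max |(x - k) / (x + k)| |(y - k) / (y + k)| < 1 ∧
      |2 * x * y / (x + y) -
          ∑ q ∈ Finset.Icc 1 N,
            (((x - k) / (x + k)) ^ (q - 1) * (2 * Real.sqrt k * x / (x + k))) *
              (((y - k) / (y + k)) ^ (q - 1) * (2 * Real.sqrt k * y / (y + k)))|
        ≤ (max |(x - k) / (x + k)| |(y - k) / (y + k)|) ^ (2 * N) *
            (2 * x * y / (x + y)) := by
  refine ⟨max_lt (abs_sub_div_add_lt_one hx.1 hk.1) (abs_sub_div_add_lt_one hy.1 hk.1), ?_⟩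
  have hS : 0 ≤ 2 * x * y / (x + y) := by
    have := hx.1
    have := hy.1
    positivity
  rw [chi2_direct_remainder hx.1 hy.1 hk.1, abs_mul, abs_of_nonneg hS, abs_pow, abs_mul, pow_mul,
    sq]
  gcongr
  · exact le_max_left _ _
  · exact le_max_right _ _
end

section
/- Let x, y > 0, let 0 < a ≤ b, and let k : ℕ → ℝ be any sequence with a ≤ k_q ≤ b for all q. With c_q(x) = (∏_{p=1}^{q−1} (x − k_p)/(x + k_p)) · (2√(k_q)·x/(x + k_q)), the series ∑_{q=1}^{∞} c_q(x)·c_q(y) converges and its sum equals 2xy/(x+y). -/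
open Finset

/-- The Blaschke-type factor `(x - t) / (x + t)` is bounded away from `1` in absolute value,
uniformly for `t` in a compact interval of positive reals. -/
theorem exists_abs_sub_div_add_le {x a b : ℝ} (hx : 0 < x) (ha : 0 < a) :
    ∃ r < 1, ∀ t ∈ Set.Icc a b, |(x - t) / (x + t)| ≤ r := by
  rcases lt_or_ge b a with hab | hab
  · exact ⟨0, one_pos, fun t ht => absurd (ht.1.trans ht.2) hab.not_ge⟩
  have hm : 0 < min x a := lt_min hx ha
  have hxb : 0 < x + b := by linarith
  refine ⟨1 - 2 * min x a / (x + b), by linarith [show 0 < 2 * min x a / (x + b) by positivity],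
    fun t ⟨hat, htb⟩ => ?_⟩
  have hxt : 0 < x + t := by linarith
  have hle : 2 * min x a / (x + b) ≤ 2 * min x a / (x + t) := by gcongr
  have habs : |x - t| ≤ x + t - 2 * min x a := by
    rw [abs_le]
    constructor <;> linarith [min_le_left x a, min_le_right x a]
  calc |(x - t) / (x + t)| = |x - t| / (x + t) := by rw [abs_div, abs_of_pos hxt]
    _ ≤ (x + t - 2 * min x a) / (x + t) := by gcongr
    _ = 1 - 2 * min x a / (x + t) := by rw [sub_div, div_self hxt.ne']
    _ ≤ 1 - 2 * min x a / (x + b) := by linarith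

/-- The partial products of a sequence bounded by some `r < 1` in absolute value are summable. -/
theorem summable_prod_Icc_of_abs_le {f : ℕ → ℝ} {r : ℝ} (hr : r < 1) (hf : ∀ p, |f p| ≤ r) :
    Summable fun q : ℕ => ∏ p ∈ Finset.Icc 1 q, f p := by
  refine Summable.of_norm_bounded
    (summable_geometric_of_lt_one ((abs_nonneg _).trans (hf 0)) hr) fun q => ?_
  rw [Real.norm_eq_abs, Finset.abs_prod]
  simpa using Finset.prod_le_prod (s := Finset.Icc 1 q) (fun p _ => abs_nonneg (f p))
    (fun p _ => hf p)

theorem chi2_direct_series_hasSum (x y : ℝ) (hx : 0 < x) (hy : 0 < y)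
    (a b : ℝ) (ha : 0 < a) (hab : a ≤ b)
    (k : ℕ → ℝ) (hk : ∀ q, k q ∈ Set.Icc a b) :
    HasSum
      (fun q : ℕ =>
        ((∏ p ∈ Finset.Icc 1 q, (x - k p) / (x + k p)) *
            (2 * Real.sqrt (k (q + 1)) * x / (x + k (q + 1)))) *
          ((∏ p ∈ Finset.Icc 1 q, (y - k p) / (y + k p)) *
            (2 * Real.sqrt (k (q + 1)) * y / (y + k (q + 1)))))
      (2 * x * y / (x + y)) := by
  obtain ⟨r, hr, hxr⟩ := exists_abs_sub_div_add_le (b := b) hx ha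
  obtain ⟨s, hs, hys⟩ := exists_abs_sub_div_add_le (b := b) hy ha
  have hbound : ∀ p, |(x - k p) / (x + k p) * ((y - k p) / (y + k p))| ≤ r := fun p => by
    rw [abs_mul]
    exact (mul_le_of_le_one_right (abs_nonneg _) ((hys _ (hk p)).trans hs.le)).trans
      (hxr _ (hk p))
  have hD := (summable_prod_Icc_of_abs_le hr hbound).hasSum
  have hdiff := (hD.sub ((hasSum_nat_add_iff' 1).mpr hD)).mul_left (2 * x * y / (x + y))
  simp only [Finset.sum_range_one, sub_sub_cancel, Finset.Icc_eq_empty (one_pos.not_ge),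
    Finset.prod_empty, mul_one] at hdiff
  refine hdiff.congr_fun fun q => ?_
  rw [Finset.prod_Icc_succ_top (Nat.le_add_left 1 q), Finset.prod_mul_distrib]
  have hkq : 0 < k (q + 1) := ha.trans_le (hk _).1
  have hsq := Real.mul_self_sqrt hkq.le
  generalize √(k (q + 1)) = w at hsq ⊢
  rw [← hsq] at hkq ⊢
  have hxk : x + w * w ≠ 0 := by positivity
  have hyk : y + w * w ≠ 0 := by positivity
  have hxy : x + y ≠ 0 := by positivity
  field_simp
  ring
end

section
/- For all real numbers x, y > 0, 2xy/(x + y) = √(xy) · ∫_{−∞}^{∞} cos(ω·(log x − log y)) · sech(πω) dω, where sech(u) = 1/cosh(u), and the integral converges. -/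
open Real MeasureTheory

lemma ofReal_sigmoid_cpow_mul_cpow (u v : ℂ) (s : ℝ) :
    |sigmoid s * (1 - sigmoid s)| •
        ((sigmoid s : ℂ) ^ (u - 1) * (1 - (sigmoid s : ℂ)) ^ (v - 1)) =
      (sigmoid s : ℂ) ^ u * (sigmoid (-s) : ℂ) ^ v := by
  have h : (1 - (sigmoid s : ℂ)) = (sigmoid (-s) : ℂ) := by
    rw [sigmoid_neg]; push_cast; rfl
  have h1 : (sigmoid s : ℂ) ≠ 0 := by exact_mod_cast (sigmoid_pos s).ne'
  have h2 : (sigmoid (-s) : ℂ) ≠ 0 := by exact_mod_cast (sigmoid_pos (-s)).ne'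
  rw [← sigmoid_neg, abs_of_pos (mul_pos (sigmoid_pos _) (sigmoid_pos _)), h,
    Complex.cpow_sub _ _ h1, Complex.cpow_sub _ _ h2, Complex.cpow_one, Complex.cpow_one,
    Complex.real_smul]
  push_cast
  field_simp

lemma integrable_sigmoid_cpow_mul_cpow {u v : ℂ} (hu : 0 < u.re) (hv : 0 < v.re) :
    Integrable fun s : ℝ ↦ (sigmoid s : ℂ) ^ u * (sigmoid (-s) : ℂ) ^ v := by
  have h := Complex.betaIntegral_convergent hu hv
  rw [intervalIntegrable_iff_integrableOn_Ioo_of_le zero_le_one, ← range_sigmoid,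
    ← Set.image_univ, integrableOn_image_iff_integrableOn_abs_deriv_smul MeasurableSet.univ
      (fun s _ ↦ (hasDerivAt_sigmoid s).hasDerivWithinAt) sigmoid_injective.injOn,
    integrableOn_univ] at h
  simpa only [ofReal_sigmoid_cpow_mul_cpow] using h

lemma betaIntegral_eq_integral_sigmoid (u v : ℂ) :
    Complex.betaIntegral u v = ∫ s : ℝ, (sigmoid s : ℂ) ^ u * (sigmoid (-s) : ℂ) ^ v := by
  rw [Complex.betaIntegral, intervalIntegral.integral_of_le zero_le_one,
    integral_Ioc_eq_integral_Ioo, ← range_sigmoid,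
    ← Set.image_univ, integral_image_eq_integral_abs_deriv_smul MeasurableSet.univ
      (fun s _ ↦ (hasDerivAt_sigmoid s).hasDerivWithinAt) sigmoid_injective.injOn,
    setIntegral_univ]
  simp only [ofReal_sigmoid_cpow_mul_cpow]

lemma log_sigmoid (s : ℝ) : log (sigmoid s) = s / 2 - log (2 * cosh (s / 2)) := by
  have hc : 0 < 2 * cosh (s / 2) := mul_pos two_pos (cosh_pos _)
  have h : sigmoid s = exp (s / 2) / (2 * cosh (s / 2)) := by
    have he : exp (-s) = exp (-(s / 2)) / exp (s / 2) := by rw [← exp_sub]; ring_nf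
    rw [sigmoid_def, cosh_eq, he]
    field_simp
  rw [h, log_div (exp_pos _).ne' hc.ne', log_exp]

lemma sigmoid_cpow_half_mul_cpow_half (τ s : ℝ) :
    (sigmoid s : ℂ) ^ (1 / 2 + τ * Complex.I) * (sigmoid (-s) : ℂ) ^ (1 / 2 - τ * Complex.I) =
      Complex.exp ((τ * s : ℝ) * Complex.I) * ((1 / (2 * cosh (s / 2)) : ℝ) : ℂ) := by
  have h1 : (sigmoid s : ℂ) ≠ 0 := by exact_mod_cast (sigmoid_pos s).ne'
  have h2 : (sigmoid (-s) : ℂ) ≠ 0 := by exact_mod_cast (sigmoid_pos (-s)).ne'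
  have hc : 0 < 2 * cosh (s / 2) := mul_pos two_pos (cosh_pos _)
  have h3 : 1 / (2 * cosh (s / 2)) = exp (-log (2 * cosh (s / 2))) := by
    rw [exp_neg, exp_log hc, one_div]
  rw [Complex.cpow_def_of_ne_zero h1, Complex.cpow_def_of_ne_zero h2,
    ← Complex.ofReal_log (sigmoid_pos _).le, ← Complex.ofReal_log (sigmoid_pos _).le,
    log_sigmoid, log_sigmoid, neg_div, cosh_neg, h3, Complex.ofReal_exp, ← Complex.exp_add,
    ← Complex.exp_add]
  congr 1
  push_cast
  ring

lemma betaIntegral_half_add_half_sub (τ : ℝ) :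
    Complex.betaIntegral (1 / 2 + τ * Complex.I) (1 / 2 - τ * Complex.I) =
      ((π / cosh (π * τ) : ℝ) : ℂ) := by
  have h : (1 / 2 - τ * Complex.I : ℂ) = 1 - (1 / 2 + τ * Complex.I) := by ring
  rw [Complex.betaIntegral_eq_Gamma_mul_div _ _ (by simp) (by simp), h,
    Complex.Gamma_mul_Gamma_one_sub, add_sub_cancel, Complex.Gamma_one, div_one]
  have h' : (π : ℂ) * (1 / 2 + τ * Complex.I) = (π * τ : ℂ) * Complex.I + π / 2 := by ring
  rw [h', Complex.sin_add_pi_div_two, Complex.cos_mul_I]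
  push_cast
  rfl

lemma exp_mul_sech_eq_sigmoid (t ω : ℝ) :
    Complex.exp ((ω * t : ℝ) * Complex.I) * ((1 / cosh (π * ω) : ℝ) : ℂ) =
      2 * ((sigmoid (2 * π * ω) : ℂ) ^ (1 / 2 + (t / (2 * π) : ℝ) * Complex.I) *
        (sigmoid (-(2 * π * ω)) : ℂ) ^ (1 / 2 - (t / (2 * π) : ℝ) * Complex.I)) := by
  have h1 : t / (2 * π) * (2 * π * ω) = ω * t := by field_simp
  have h2 : 2 * π * ω / 2 = π * ω := by ring
  rw [sigmoid_cpow_half_mul_cpow_half, h1, h2]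
  push_cast
  ring

lemma integrable_exp_mul_sech (t : ℝ) :
    Integrable fun ω : ℝ ↦
      Complex.exp ((ω * t : ℝ) * Complex.I) * ((1 / cosh (π * ω) : ℝ) : ℂ) := by
  simp only [exp_mul_sech_eq_sigmoid]
  generalize t / (2 * π) = τ
  exact ((integrable_sigmoid_cpow_mul_cpow (by simp) (by simp)).comp_mul_left'
    two_pi_pos.ne').const_mul 2

/-- The Fourier transform of the hyperbolic secant. -/
lemma integral_exp_mul_sech (t : ℝ) :
    ∫ ω : ℝ, Complex.exp ((ω * t : ℝ) * Complex.I) * ((1 / cosh (π * ω) : ℝ) : ℂ) =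
      ((1 / cosh (t / 2) : ℝ) : ℂ) := by
  simp only [exp_mul_sech_eq_sigmoid]
  rw [integral_const_mul, Measure.integral_comp_mul_left (fun s : ℝ ↦
      (sigmoid s : ℂ) ^ (1 / 2 + (t / (2 * π) : ℝ) * Complex.I) *
        (sigmoid (-s) : ℂ) ^ (1 / 2 - (t / (2 * π) : ℝ) * Complex.I)),
    ← betaIntegral_eq_integral_sigmoid, betaIntegral_half_add_half_sub,
    abs_of_pos (inv_pos.2 two_pi_pos), Complex.real_smul]
  have h : π * (t / (2 * π)) = t / 2 := by field_simp
  rw [h]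
  norm_cast
  field_simp

lemma re_exp_mul_sech (t ω : ℝ) :
    (Complex.exp ((ω * t : ℝ) * Complex.I) * ((1 / cosh (π * ω) : ℝ) : ℂ)).re =
      cos (ω * t) * (1 / cosh (π * ω)) := by
  rw [Complex.re_mul_ofReal, Complex.exp_ofReal_mul_I_re]

lemma integrable_cos_mul_sech (t : ℝ) :
    Integrable fun ω : ℝ ↦ cos (ω * t) * (1 / cosh (π * ω)) := by
  simpa only [RCLike.re_to_complex, re_exp_mul_sech] using (integrable_exp_mul_sech t).re

lemma integral_cos_mul_sech (t : ℝ) :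
    ∫ ω : ℝ, cos (ω * t) * (1 / cosh (π * ω)) = 1 / cosh (t / 2) := by
  have h := integral_re (integrable_exp_mul_sech t)
  rw [integral_exp_mul_sech] at h
  simpa only [RCLike.re_to_complex, re_exp_mul_sech, Complex.ofReal_re] using h

lemma cosh_log_sub_log_div_two {x y : ℝ} (hx : 0 < x) (hy : 0 < y) :
    cosh ((log x - log y) / 2) = (x + y) / (2 * √(x * y)) := by
  have h1 : exp (log x / 2) = √x := by rw [exp_half, exp_log hx]
  have h2 : exp (log y / 2) = √y := by rw [exp_half, exp_log hy]
  rw [cosh_eq, ← neg_div, neg_sub, sub_div, sub_div, exp_sub, exp_sub, h1, h2, sqrt_mul hx.le]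
  have := sqrt_pos.2 hx
  have := sqrt_pos.2 hy
  field_simp
  rw [sq_sqrt hx.le, sq_sqrt hy.le]

theorem chi2_fourier_integral_representation (x y : ℝ) (hx : 0 < x) (hy : 0 < y) :
    Integrable (fun ω : ℝ =>
        Real.cos (ω * (Real.log x - Real.log y)) * (1 / Real.cosh (π * ω))) ∧
      2 * x * y / (x + y) =
        Real.sqrt (x * y) *
          ∫ ω : ℝ, Real.cos (ω * (Real.log x - Real.log y)) * (1 / Real.cosh (π * ω)) := by
  refine ⟨integrable_cos_mul_sech _, ?_⟩
  rw [integral_cos_mul_sech, cosh_log_sub_log_div_two hx hy, one_div_div, mul_div_assoc',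
    mul_left_comm, mul_self_sqrt (mul_pos hx hy).le, mul_assoc]
end

section
/- For every real x > 0, (2/π) · ∫_0^π cos((log x/π)·log(tan(z/2))) dz = 4√x/(x + 1); equivalently, this zeroth Fourier cosine coefficient equals 2·sech((log x)/2). -/
open Real intervalIntegral

/-- The half-angle substitution `t = sin² (z / 2)` maps `(0, π)` onto `(0, 1)`. -/
theorem image_sin_half_sq_Ioo :
    (fun z : ℝ => Real.sin (z / 2) ^ 2) '' Set.Ioo 0 π = Set.Ioo 0 1 := by
  apply Set.Subset.antisymm
  · rintro _ ⟨z, ⟨h0, h1⟩, rfl⟩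
    have hs : 0 < Real.sin (z / 2) := Real.sin_pos_of_pos_of_lt_pi (by linarith) (by linarith)
    have hc : 0 < Real.cos (z / 2) :=
      Real.cos_pos_of_mem_Ioo ⟨by linarith, by linarith⟩
    have := Real.sin_sq_add_cos_sq (z / 2)
    exact ⟨by positivity, by nlinarith [pow_pos hc 2]⟩
  · have h := intermediate_value_Ioo (f := fun z : ℝ => Real.sin (z / 2) ^ 2) Real.pi_pos.le
      (by fun_prop)
    simpa using h

theorem injOn_sin_half_sq_Ioo :
    Set.InjOn (fun z : ℝ => Real.sin (z / 2) ^ 2) (Set.Ioo 0 π) := by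
  rintro z ⟨hz0, hz1⟩ w ⟨hw0, hw1⟩ h
  have hs : 0 < Real.sin (z / 2) := Real.sin_pos_of_pos_of_lt_pi (by linarith) (by linarith)
  have ht : 0 < Real.sin (w / 2) := Real.sin_pos_of_pos_of_lt_pi (by linarith) (by linarith)
  have h' := (sq_eq_sq₀ hs.le ht.le).1 h
  have := Real.injOn_sin ⟨by linarith, by linarith⟩ ⟨by linarith, by linarith⟩ h'
  linarith

theorem hasDerivAt_sin_half_sq (z : ℝ) :
    HasDerivAt (fun z : ℝ => Real.sin (z / 2) ^ 2) (Real.sin (z / 2) * Real.cos (z / 2)) z := by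
  have h := (((hasDerivAt_id z).div_const 2).sin).pow 2
  refine h.congr_deriv ?_
  simp only [id]
  push_cast
  ring

/-- The real part of the beta integrand with conjugate parameters `(1 ± i s) / 2`. -/
theorem re_betaIntegrand_conj (s : ℝ) {a b : ℝ} (ha : 0 < a) (hb : 0 < b) :
    (((a ^ 2 : ℝ) : ℂ) ^ ((1 + s * Complex.I) / 2 - 1) *
      ((b ^ 2 : ℝ) : ℂ) ^ ((1 - s * Complex.I) / 2 - 1)).re =
      (a * b)⁻¹ * Real.cos (s * Real.log (a / b)) := by
  have ha2 : ((a ^ 2 : ℝ) : ℂ) ≠ 0 := by exact_mod_cast (pow_pos ha 2).ne'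
  have hb2 : ((b ^ 2 : ℝ) : ℂ) ≠ 0 := by exact_mod_cast (pow_pos hb 2).ne'
  rw [Complex.cpow_def_of_ne_zero ha2, Complex.cpow_def_of_ne_zero hb2, ← Complex.exp_add,
    ← Complex.ofReal_log (by positivity), ← Complex.ofReal_log (by positivity),
    Real.log_pow, Real.log_pow, Real.log_div ha.ne' hb.ne']
  have h : (((2 : ℕ) * Real.log a : ℝ) : ℂ) * ((1 + s * Complex.I) / 2 - 1) +
      (((2 : ℕ) * Real.log b : ℝ) : ℂ) * ((1 - s * Complex.I) / 2 - 1) =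
      ((-(Real.log a + Real.log b) : ℝ) : ℂ) +
        ((s * (Real.log a - Real.log b) : ℝ) : ℂ) * Complex.I := by
    push_cast
    ring
  rw [h, Complex.exp_re]
  simp only [Complex.add_re, Complex.add_im, Complex.re_ofReal_mul, Complex.im_ofReal_mul,
    Complex.ofReal_re, Complex.ofReal_im, Complex.I_re, Complex.I_im, mul_zero, mul_one, add_zero,
    zero_add]
  rw [Real.exp_neg, Real.exp_add, Real.exp_log ha, Real.exp_log hb]

theorem betaIntegral_conj_half (s : ℝ) :
    Complex.betaIntegral ((1 + s * Complex.I) / 2) ((1 - s * Complex.I) / 2) =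
      ((π / Real.cosh (π * s / 2) : ℝ) : ℂ) := by
  have h := Complex.Gamma_mul_Gamma_eq_betaIntegral (s := (1 + s * Complex.I) / 2)
    (t := (1 - s * Complex.I) / 2) (by simp) (by simp)
  have hsum : (1 + s * Complex.I) / 2 + (1 - s * Complex.I) / 2 = 1 := by ring
  have hone : (1 - s * Complex.I) / 2 = 1 - (1 + s * Complex.I) / 2 := by ring
  rw [hsum, Complex.Gamma_one, one_mul] at h
  rw [← h, hone, Complex.Gamma_mul_Gamma_one_sub]
  have harg : (π : ℂ) * ((1 + s * Complex.I) / 2) = (π * s / 2 : ℂ) * Complex.I + π / 2 := by ring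
  rw [harg, Complex.sin_add_pi_div_two, Complex.cos_mul_I]
  push_cast
  rfl

theorem integral_cos_mul_log_tan_half (s : ℝ) :
    ∫ z in (0 : ℝ)..π, Real.cos (s * Real.log (Real.tan (z / 2))) =
      π / Real.cosh (π * s / 2) := by
  set u : ℂ := (1 + s * Complex.I) / 2 with hu
  set v : ℂ := (1 - s * Complex.I) / 2 with hv
  have hconv := Complex.betaIntegral_convergent (u := u) (v := v) (by simp [hu]) (by simp [hv])
  have hbeta := betaIntegral_conj_half s
  rw [← hu, ← hv, Complex.betaIntegral, integral_of_le zero_le_one,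
    MeasureTheory.integral_Ioc_eq_integral_Ioo] at hbeta
  rw [intervalIntegrable_iff_integrableOn_Ioo_of_le zero_le_one] at hconv
  have hre := integral_re hconv
  rw [hbeta] at hre
  rw [integral_of_le Real.pi_pos.le, MeasureTheory.integral_Ioc_eq_integral_Ioo]
  rw [← image_sin_half_sq_Ioo, MeasureTheory.integral_image_eq_integral_abs_deriv_smul
    measurableSet_Ioo (fun z _ => (hasDerivAt_sin_half_sq z).hasDerivWithinAt)
    injOn_sin_half_sq_Ioo] at hre
  simp only [RCLike.re_to_complex, Complex.ofReal_re] at hre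
  rw [← hre]
  refine MeasureTheory.setIntegral_congr_fun measurableSet_Ioo ?_
  rintro z ⟨h0, h1⟩
  have hs : 0 < Real.sin (z / 2) := Real.sin_pos_of_pos_of_lt_pi (by linarith) (by linarith)
  have hc : 0 < Real.cos (z / 2) := Real.cos_pos_of_mem_Ioo ⟨by linarith, by linarith⟩
  have hcos : (1 : ℂ) - ((Real.sin (z / 2) ^ 2 : ℝ) : ℂ) = ((Real.cos (z / 2) ^ 2 : ℝ) : ℂ) := by
    rw [Real.cos_sq']
    push_cast
    rfl
  simp only [hcos, smul_eq_mul]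
  rw [hu, hv, re_betaIntegrand_conj s hs hc, abs_of_pos (mul_pos hs hc), Real.tan_eq_sin_div_cos,
    mul_inv_cancel_left₀ (mul_pos hs hc).ne']

theorem cosh_log_div_two {x : ℝ} (hx : 0 < x) :
    Real.cosh (Real.log x / 2) = (x + 1) / (2 * √x) := by
  have hsq := Real.sq_sqrt hx.le
  have hpos := Real.sqrt_pos.2 hx
  rw [← Real.log_sqrt hx.le, Real.cosh_log hpos]
  field_simp
  rw [hsq]

theorem chi2_chebyshev_a0 (x : ℝ) (hx : 0 < x) :
    (2 / π) * ∫ z in (0 : ℝ)..π, Real.cos ((Real.log x / π) * Real.log (Real.tan (z / 2)))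
        = 4 * Real.sqrt x / (x + 1) ∧
      (2 / π) * ∫ z in (0 : ℝ)..π, Real.cos ((Real.log x / π) * Real.log (Real.tan (z / 2)))
        = 2 * (1 / Real.cosh (Real.log x / 2)) := by
  have hπ := Real.pi_ne_zero
  have hsqrt := (Real.sqrt_pos.2 hx).ne'
  have hx1 : x + 1 ≠ 0 := by positivity
  rw [integral_cos_mul_log_tan_half, mul_div_cancel₀ _ hπ, cosh_log_div_two hx]
  constructor
  · field_simp
    norm_num
  · field_simp
end

section
/- Let x > 0 with x ≠ 1, and for each natural number q define a_q(x) = (2/π)∫_0^π cos((log x/π)·log(tan(z/2)))·cos(qz) dz and b_q(x) = (2/π)∫_0^π sin((log x/π)·log(tan(z/2)))·cos(qz) dz. Then for every q ≥ 1: (log x/π)·b_q(x) = ((q+1)/2)·a_{q+1}(x) − ((q−1)/2)·a_{q−1}(x). -/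
open Real intervalIntegral

/-- The q-th Fourier cosine coefficient of `cos((log x/π) log tan(z/2))` on `[0, π]`. -/
noncomputable def chebA (x : ℝ) (q : ℕ) : ℝ :=
  (2 / π) * ∫ z in (0 : ℝ)..π,
    Real.cos ((Real.log x / π) * Real.log (Real.tan (z / 2))) * Real.cos (q * z)

/-- The q-th Fourier cosine coefficient of `sin((log x/π) log tan(z/2))` on `[0, π]`. -/
noncomputable def chebB (x : ℝ) (q : ℕ) : ℝ :=
  (2 / π) * ∫ z in (0 : ℝ)..π,
    Real.sin ((Real.log x / π) * Real.log (Real.tan (z / 2))) * Real.cos (q * z)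

theorem hasDerivAt_log_tan_half {z : ℝ} (hz : z ∈ Set.Ioo 0 π) :
    HasDerivAt (fun z => Real.log (Real.tan (z / 2))) (Real.sin z)⁻¹ z := by
  have hs : 0 < Real.sin (z / 2) :=
    Real.sin_pos_of_pos_of_lt_pi (by linarith [hz.1]) (by linarith [hz.1, hz.2])
  have hc : 0 < Real.cos (z / 2) :=
    Real.cos_pos_of_mem_Ioo ⟨by linarith [hz.1, Real.pi_pos], by linarith [hz.2]⟩
  have ht : Real.tan (z / 2) ≠ 0 := by
    rw [Real.tan_eq_sin_div_cos]; positivity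
  have h := (HasDerivAt.comp z (h := fun z : ℝ => z / 2) (Real.hasDerivAt_tan hc.ne')
    ((hasDerivAt_id z).div_const 2)).log ht
  have hsz : Real.sin z = 2 * Real.sin (z / 2) * Real.cos (z / 2) := by
    rw [← Real.sin_two_mul]; ring_nf
  refine h.congr_deriv ?_
  simp only [Function.comp]
  rw [hsz, Real.tan_eq_sin_div_cos]
  field_simp

theorem measurable_log_tan_half : Measurable fun z : ℝ => Real.log (Real.tan (z / 2)) := by
  simp only [Real.tan_eq_sin_div_cos]
  fun_prop

theorem intervalIntegrable_of_measurable_of_bound {f : ℝ → ℝ} (hf : Measurable f) (C : ℝ)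
    (hC : ∀ z, ‖f z‖ ≤ C) (a b : ℝ) :
    IntervalIntegrable f MeasureTheory.volume a b :=
  (intervalIntegrable_const (c := C)).mono_fun hf.aestronglyMeasurable
    (Filter.Eventually.of_forall fun z => (hC z).trans (Real.le_norm_self C))

theorem intervalIntegrable_cos_mul_log_tan_half_mul_cos (c r a b : ℝ) :
    IntervalIntegrable
      (fun z => Real.cos (c * Real.log (Real.tan (z / 2))) * Real.cos (r * z))
      MeasureTheory.volume a b := by
  have := measurable_log_tan_half
  refine intervalIntegrable_of_measurable_of_bound (by fun_prop) 1 (fun z => ?_) a b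
  rw [norm_mul]
  exact mul_le_one₀ (Real.abs_cos_le_one _) (norm_nonneg _) (Real.abs_cos_le_one _)

theorem intervalIntegrable_sin_mul_log_tan_half_mul_cos (c r a b : ℝ) :
    IntervalIntegrable
      (fun z => Real.sin (c * Real.log (Real.tan (z / 2))) * Real.cos (r * z))
      MeasureTheory.volume a b := by
  have := measurable_log_tan_half
  refine intervalIntegrable_of_measurable_of_bound (by fun_prop) 1 (fun z => ?_) a b
  rw [norm_mul]
  exact mul_le_one₀ (Real.abs_sin_le_one _) (norm_nonneg _) (Real.abs_cos_le_one _)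

/-- The product rule for `cos (c log tan (z / 2)) * (sin z * cos (r z))`, with the trigonometric
products expanded into sums. -/
theorem hasDerivAt_cos_mul_log_tan_half_mul (c r : ℝ) {z : ℝ} (hz : z ∈ Set.Ioo 0 π) :
    HasDerivAt
      (fun z => Real.cos (c * Real.log (Real.tan (z / 2))) * (Real.sin z * Real.cos (r * z)))
      ((r + 1) / 2 * (Real.cos (c * Real.log (Real.tan (z / 2))) * Real.cos ((r + 1) * z))
        - (r - 1) / 2 * (Real.cos (c * Real.log (Real.tan (z / 2))) * Real.cos ((r - 1) * z))
        - c * (Real.sin (c * Real.log (Real.tan (z / 2))) * Real.cos (r * z))) z := by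
  have hs : Real.sin z ≠ 0 := (Real.sin_pos_of_mem_Ioo hz).ne'
  have h := ((hasDerivAt_log_tan_half hz).const_mul c).cos.mul
    ((Real.hasDerivAt_sin z).mul ((hasDerivAt_id z).const_mul r).cos)
  refine h.congr_deriv ?_
  have h1 : (r + 1) * z = r * z + z := by ring
  have h2 : (r - 1) * z = r * z - z := by ring
  simp only [id, Pi.mul_apply]
  rw [h1, h2, Real.cos_add, Real.cos_sub]
  field_simp
  ring

theorem continuousOn_cos_mul_log_tan_half_mul (c r : ℝ) :
    ContinuousOn
      (fun z => Real.cos (c * Real.log (Real.tan (z / 2))) * (Real.sin z * Real.cos (r * z)))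
      (Set.Icc 0 π) := by
  have hzero : ∀ z₀, Real.sin z₀ = 0 → ContinuousAt
      (fun z => Real.cos (c * Real.log (Real.tan (z / 2))) * (Real.sin z * Real.cos (r * z)))
      z₀ := by
    intro z₀ h₀
    have hlim : Filter.Tendsto (fun z => |Real.sin z|) (nhds z₀) (nhds 0) := by
      simpa [h₀] using (Real.continuous_sin.abs.tendsto z₀)
    rw [ContinuousAt, h₀, zero_mul, mul_zero]
    refine squeeze_zero_norm (fun z => ?_) hlim
    rw [norm_mul, norm_mul]
    exact (mul_le_of_le_one_left (by positivity) (Real.abs_cos_le_one _)).trans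
      (mul_le_of_le_one_right (norm_nonneg _) (Real.abs_cos_le_one _))
  intro z hz
  refine ContinuousAt.continuousWithinAt ?_
  rcases hz.1.eq_or_lt with rfl | h0
  · exact hzero _ Real.sin_zero
  rcases hz.2.eq_or_lt with rfl | hπ
  · exact hzero _ Real.sin_pi
  exact (hasDerivAt_cos_mul_log_tan_half_mul c r ⟨h0, hπ⟩).continuousAt

theorem integral_sin_mul_log_tan_half_mul_cos (c r : ℝ) :
    c * ∫ z in (0 : ℝ)..π, Real.sin (c * Real.log (Real.tan (z / 2))) * Real.cos (r * z) =
      (r + 1) / 2 * (∫ z in (0 : ℝ)..π,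
        Real.cos (c * Real.log (Real.tan (z / 2))) * Real.cos ((r + 1) * z)) -
      (r - 1) / 2 * ∫ z in (0 : ℝ)..π,
        Real.cos (c * Real.log (Real.tan (z / 2))) * Real.cos ((r - 1) * z) := by
  have h1 := (intervalIntegrable_cos_mul_log_tan_half_mul_cos c (r + 1) 0 π).const_mul ((r + 1) / 2)
  have h2 := (intervalIntegrable_cos_mul_log_tan_half_mul_cos c (r - 1) 0 π).const_mul ((r - 1) / 2)
  have h3 := (intervalIntegrable_sin_mul_log_tan_half_mul_cos c r 0 π).const_mul c
  have h := integral_eq_sub_of_hasDerivAt_of_le Real.pi_pos.le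
    (continuousOn_cos_mul_log_tan_half_mul c r)
    (fun z hz => hasDerivAt_cos_mul_log_tan_half_mul c r hz) ((h1.sub h2).sub h3)
  rw [integral_sub (h1.sub h2) h3, integral_sub h1 h2] at h
  simp only [integral_const_mul, Real.sin_pi, Real.sin_zero, zero_mul, mul_zero, sub_zero] at h
  linarith

theorem chebyshev_recurrence_b (x : ℝ) (hx : 0 < x) (hx1 : x ≠ 1) (q : ℕ) (hq : 1 ≤ q) :
    (Real.log x / π) * chebB x q =
      (((q : ℝ) + 1) / 2) * chebA x (q + 1) - (((q : ℝ) - 1) / 2) * chebA x (q - 1) := by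
  have h := integral_sin_mul_log_tan_half_mul_cos (Real.log x / π) q
  simp only [chebA, chebB]
  push_cast [Nat.cast_sub hq]
  linear_combination (2 / π) * h
end
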